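/- Let (u⁽ⁿ⁾) be a sequence of admissible controls and û an admissible control such that for every ρ ∈ L¹[0,T] one has ∫₀ᵀ ρ(ξ) u⁽ⁿ⁾(ξ) dξ → ∫₀ᵀ ρ(ξ) û(ξ) dξ as n → ∞. Then the costs converge: J(u⁽ⁿ⁾) = ∫₀ᵀ (α (Ku⁽ⁿ⁾)(t) + β u⁽ⁿ⁾(t)) dt → ∫₀ᵀ (α (Kû)(t) + β û(t)) dt = J(û) as n → ∞. -/

import Mathlib

open MeasureTheory Real

/-- An admissible control: measurable, with values in `[0, u₁]` a.e. on `[0, T]`. -/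
def Admissible (T u₁ : ℝ) (u : ℝ → ℝ) : Prop :=
  Measurable u ∧ ∀ᵐ t ∂(volume.restrict (Set.Icc (0:ℝ) T)), u t ∈ Set.Icc (0:ℝ) u₁

/-- The state `(Ku)(t) = R₀ exp(−∫₀ᵗ u) + c ∫₀ᵗ exp(−∫ₛᵗ u) ds`. -/
noncomputable def Kstate (R₀ c : ℝ) (u : ℝ → ℝ) (t : ℝ) : ℝ :=
  R₀ * Real.exp (-(∫ ξ in (0:ℝ)..t, u ξ)) +
    c * ∫ s in (0:ℝ)..t, Real.exp (-(∫ ξ in s..t, u ξ))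

/-- The cost `J(u) = ∫₀ᵀ (α (Ku)(t) + β u(t)) dt`. -/
noncomputable def Jcost (α β c T R₀ : ℝ) (u : ℝ → ℝ) : ℝ :=
  ∫ t in (0:ℝ)..T, (α * Kstate R₀ c u t + β * u t)

theorem Admissible.integrableOn {T u₁ : ℝ} {u : ℝ → ℝ} (hu : Admissible T u₁ u) :
    IntegrableOn u (Set.Icc (0:ℝ) T) := by
  refine Measure.integrableOn_of_bounded (M := u₁) (by simp) hu.1.aestronglyMeasurable ?_
  filter_upwards [hu.2] with t ht
  rw [Real.norm_eq_abs, abs_of_nonneg ht.1]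
  exact ht.2

theorem Admissible.intervalIntegrable {T u₁ : ℝ} {u : ℝ → ℝ} (hu : Admissible T u₁ u) {s t : ℝ}
    (hs : s ∈ Set.Icc (0:ℝ) T) (ht : t ∈ Set.Icc (0:ℝ) T) : IntervalIntegrable u volume s t :=
  (hu.integrableOn.mono_set (Set.uIcc_subset_Icc hs ht)).intervalIntegrable

theorem Admissible.continuousOn_primitive {T u₁ : ℝ} {u : ℝ → ℝ} (hu : Admissible T u₁ u) :
    ContinuousOn (fun t => ∫ ξ in (0:ℝ)..t, u ξ) (Set.Icc (0:ℝ) T) := by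
  rcases le_or_gt 0 T with hT | hT
  · have h := intervalIntegral.continuousOn_primitive_interval (μ := volume) (f := u) (a := 0)
      (b := T) (by rw [Set.uIcc_of_le hT]; exact hu.integrableOn)
    rwa [Set.uIcc_of_le hT] at h
  · simp [Set.Icc_eq_empty_of_lt hT]

theorem Admissible.primitive_mem_Icc {T u₁ : ℝ} {u : ℝ → ℝ} (hu : Admissible T u₁ u) (hu₁ : 0 ≤ u₁)
    {t : ℝ} (ht : t ∈ Set.Icc (0:ℝ) T) :
    ∫ ξ in (0:ℝ)..t, u ξ ∈ Set.Icc 0 (u₁ * T) := by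
  have hae : ∀ᵐ ξ ∂(volume.restrict (Set.Icc (0:ℝ) t)), u ξ ∈ Set.Icc (0:ℝ) u₁ :=
    ae_restrict_of_ae_restrict_of_subset (Set.Icc_subset_Icc_right ht.2) hu.2
  have h0 : (0:ℝ) ∈ Set.Icc (0:ℝ) T := ⟨le_rfl, ht.1.trans ht.2⟩
  constructor
  · exact intervalIntegral.integral_nonneg_of_ae_restrict ht.1 (hae.mono fun ξ h => h.1)
  · calc ∫ ξ in (0:ℝ)..t, u ξ ≤ ∫ _ in (0:ℝ)..t, u₁ :=
          intervalIntegral.integral_mono_ae_restrict ht.1 (hu.intervalIntegrable h0 ht) (by simp)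
            (hae.mono fun ξ h => h.2)
      _ = u₁ * t := by simp [mul_comm]
      _ ≤ u₁ * T := mul_le_mul_of_nonneg_left ht.2 hu₁

/-- The state in terms of the primitive of the control: the exponential of `∫ₛᵗ u` factors. -/
theorem Admissible.Kstate_eq {T u₁ : ℝ} {u : ℝ → ℝ} (hu : Admissible T u₁ u) (R₀ c : ℝ) {t : ℝ}
    (ht : t ∈ Set.Icc (0:ℝ) T) :
    Kstate R₀ c u t = Real.exp (-(∫ ξ in (0:ℝ)..t, u ξ)) *
      (R₀ + c * ∫ s in (0:ℝ)..t, Real.exp (∫ ξ in (0:ℝ)..s, u ξ)) := by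
  have h0 : (0:ℝ) ∈ Set.Icc (0:ℝ) T := ⟨le_rfl, ht.1.trans ht.2⟩
  have h : ∫ s in (0:ℝ)..t, Real.exp (-(∫ ξ in s..t, u ξ)) =
      ∫ s in (0:ℝ)..t, Real.exp (-(∫ ξ in (0:ℝ)..t, u ξ)) * Real.exp (∫ ξ in (0:ℝ)..s, u ξ) := by
    refine intervalIntegral.integral_congr fun s hs => ?_
    have hs' : s ∈ Set.Icc (0:ℝ) T := Set.uIcc_subset_Icc h0 ht hs
    rw [← Real.exp_add, ← intervalIntegral.integral_interval_sub_left
      (hu.intervalIntegrable h0 ht) (hu.intervalIntegrable h0 hs')]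
    ring_nf
  rw [Kstate, h, intervalIntegral.integral_const_mul]
  ring

theorem Admissible.continuousOn_Kstate {T u₁ : ℝ} {u : ℝ → ℝ} (hu : Admissible T u₁ u)
    (R₀ c : ℝ) (hT : 0 ≤ T) : ContinuousOn (Kstate R₀ c u) (Set.Icc (0:ℝ) T) := by
  have hexp : ContinuousOn (fun s => Real.exp (∫ ξ in (0:ℝ)..s, u ξ)) (Set.Icc (0:ℝ) T) :=
    hu.continuousOn_primitive.rexp
  have hint : ContinuousOn (fun t => ∫ s in (0:ℝ)..t, Real.exp (∫ ξ in (0:ℝ)..s, u ξ))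
      (Set.Icc (0:ℝ) T) := by
    have h := intervalIntegral.continuousOn_primitive_interval (μ := volume) (a := 0) (b := T)
      (f := fun s => Real.exp (∫ ξ in (0:ℝ)..s, u ξ))
      (by rw [Set.uIcc_of_le hT]; exact hexp.integrableOn_Icc)
    rwa [Set.uIcc_of_le hT] at h
  exact (hu.continuousOn_primitive.neg.rexp.mul
    (continuousOn_const.add (continuousOn_const.mul hint))).congr fun t ht => hu.Kstate_eq R₀ c ht

theorem Admissible.abs_Kstate_le {T u₁ : ℝ} {u : ℝ → ℝ} (hu : Admissible T u₁ u) (hu₁ : 0 ≤ u₁)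
    (R₀ c : ℝ) {t : ℝ} (ht : t ∈ Set.Icc (0:ℝ) T) :
    |Kstate R₀ c u t| ≤ |R₀| + |c| * (Real.exp (u₁ * T) * T) := by
  have h0 : (0:ℝ) ∈ Set.Icc (0:ℝ) T := ⟨le_rfl, ht.1.trans ht.2⟩
  have hint : |∫ s in (0:ℝ)..t, Real.exp (∫ ξ in (0:ℝ)..s, u ξ)| ≤ Real.exp (u₁ * T) * T := by
    have h := intervalIntegral.norm_integral_le_of_norm_le_const (a := 0) (b := t)
      (f := fun s => Real.exp (∫ ξ in (0:ℝ)..s, u ξ)) (C := Real.exp (u₁ * T)) fun s hs => by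
        rw [Real.norm_eq_abs, Real.abs_exp]
        exact Real.exp_le_exp.2 (hu.primitive_mem_Icc hu₁
          (Set.uIcc_subset_Icc h0 ht (Set.uIoc_subset_uIcc hs))).2
    rw [sub_zero, abs_of_nonneg ht.1, Real.norm_eq_abs] at h
    exact h.trans (mul_le_mul_of_nonneg_left ht.2 (Real.exp_pos _).le)
  rw [hu.Kstate_eq R₀ c ht, abs_mul, Real.abs_exp]
  calc _ ≤ 1 * |R₀ + c * ∫ s in (0:ℝ)..t, Real.exp (∫ ξ in (0:ℝ)..s, u ξ)| := by
        gcongr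
        exact Real.exp_le_one_iff.2 (neg_nonpos.2 (hu.primitive_mem_Icc hu₁ ht).1)
    _ ≤ |R₀| + |c * ∫ s in (0:ℝ)..t, Real.exp (∫ ξ in (0:ℝ)..s, u ξ)| := by
        rw [one_mul]; exact abs_add_le _ _
    _ ≤ _ := by rw [abs_mul]; gcongr

open Filter in
/-- Weak-* convergence, tested on indicators, gives pointwise convergence of the primitives. -/
theorem tendsto_primitive_of_weakStar {T : ℝ} {uN : ℕ → ℝ → ℝ} {uo : ℝ → ℝ}
    (hweak : ∀ ρ : ℝ → ℝ, IntegrableOn ρ (Set.Icc (0:ℝ) T) →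
      Tendsto (fun n => ∫ ξ in (0:ℝ)..T, ρ ξ * uN n ξ) atTop
        (nhds (∫ ξ in (0:ℝ)..T, ρ ξ * uo ξ))) {t : ℝ} (ht : t ∈ Set.Icc (0:ℝ) T) :
    Tendsto (fun n => ∫ ξ in (0:ℝ)..t, uN n ξ) atTop (nhds (∫ ξ in (0:ℝ)..t, uo ξ)) := by
  have key : ∀ v : ℝ → ℝ, ∫ ξ in (0:ℝ)..T, (Set.Iic t).indicator 1 ξ * v ξ =
      ∫ ξ in (0:ℝ)..t, v ξ := fun v => by
    rw [← intervalIntegral.integral_indicator ht]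
    refine intervalIntegral.integral_congr fun ξ _ => ?_
    by_cases h : ξ ≤ t <;> simp [Set.indicator, h]
  have h := hweak ((Set.Iic t).indicator 1)
    ((integrableOn_const (C := (1:ℝ)) (by simp)).indicator measurableSet_Iic)
  simpa only [key] using h

open Filter in
theorem tendsto_Kstate_of_tendsto_primitive {T u₁ : ℝ} (hu₁ : 0 ≤ u₁) (R₀ c : ℝ)
    {uN : ℕ → ℝ → ℝ} (huN : ∀ n, Admissible T u₁ (uN n))
    {uo : ℝ → ℝ} (huo : Admissible T u₁ uo)
    (hprim : ∀ t ∈ Set.Icc (0:ℝ) T,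
      Tendsto (fun n => ∫ ξ in (0:ℝ)..t, uN n ξ) atTop (nhds (∫ ξ in (0:ℝ)..t, uo ξ)))
    {t : ℝ} (ht : t ∈ Set.Icc (0:ℝ) T) :
    Tendsto (fun n => Kstate R₀ c (uN n) t) atTop (nhds (Kstate R₀ c uo t)) := by
  have h0 : (0:ℝ) ∈ Set.Icc (0:ℝ) T := ⟨le_rfl, ht.1.trans ht.2⟩
  have hsub : Set.uIoc 0 t ⊆ Set.Icc 0 T :=
    Set.uIoc_subset_uIcc.trans (Set.uIcc_subset_Icc h0 ht)
  rw [huo.Kstate_eq R₀ c ht]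
  simp only [fun n => (huN n).Kstate_eq R₀ c ht]
  refine ((Real.continuous_exp.tendsto _).comp (hprim t ht).neg).mul
    (tendsto_const_nhds.add (tendsto_const_nhds.mul ?_))
  refine intervalIntegral.tendsto_integral_filter_of_dominated_convergence
    (fun _ => Real.exp (u₁ * T)) (Eventually.of_forall fun n => ?_)
    (Eventually.of_forall fun n => ae_of_all _ fun s hs => ?_) (by simp)
    (ae_of_all _ fun s hs => (Real.continuous_exp.tendsto _).comp (hprim s (hsub hs)))
  · exact ((huN n).continuousOn_primitive.rexp.mono hsub).aestronglyMeasurable measurableSet_uIoc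
  · rw [Real.norm_eq_abs, Real.abs_exp]
    exact Real.exp_le_exp.2 ((huN n).primitive_mem_Icc hu₁ (hsub hs)).2

theorem Admissible.Jcost_eq {T u₁ : ℝ} {u : ℝ → ℝ} (hu : Admissible T u₁ u) (hT : 0 ≤ T)
    (α β c R₀ : ℝ) :
    Jcost α β c T R₀ u =
      α * (∫ t in (0:ℝ)..T, Kstate R₀ c u t) + β * ∫ t in (0:ℝ)..T, u t := by
  rw [Jcost, intervalIntegral.integral_add, intervalIntegral.integral_const_mul,
    intervalIntegral.integral_const_mul]
  · exact ((hu.continuousOn_Kstate R₀ c hT).intervalIntegrable_of_Icc hT).const_mul α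
  · exact (hu.intervalIntegrable ⟨le_rfl, hT⟩ ⟨hT, le_rfl⟩).const_mul β

open Filter in
/-- weak-* convergence of admissible controls implies convergence of the costs. -/
theorem Jcost_tendsto_of_weakStar (α β c u₁ T R₀ : ℝ)
    (hα : 0 < α) (hβ : 0 < β) (hc : 0 < c) (hu₁ : 0 < u₁) (hT : 0 < T)
    (uN : ℕ → ℝ → ℝ) (huN : ∀ n, Admissible T u₁ (uN n))
    (uo : ℝ → ℝ) (huo : Admissible T u₁ uo)
    (hweak : ∀ ρ : ℝ → ℝ, IntegrableOn ρ (Set.Icc (0:ℝ) T) →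
      Tendsto (fun n => ∫ ξ in (0:ℝ)..T, ρ ξ * uN n ξ) atTop
        (nhds (∫ ξ in (0:ℝ)..T, ρ ξ * uo ξ))) :
    Tendsto (fun n => Jcost α β c T R₀ (uN n)) atTop (nhds (Jcost α β c T R₀ uo)) := by
  have hprim := fun t (ht : t ∈ Set.Icc (0:ℝ) T) => tendsto_primitive_of_weakStar hweak ht
  have hsub : Set.uIoc 0 T ⊆ Set.Icc 0 T := by
    rw [Set.uIoc_of_le hT.le]
    exact Set.Ioc_subset_Icc_self
  rw [huo.Jcost_eq hT.le]
  simp only [fun n => (huN n).Jcost_eq hT.le α β c R₀]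
  refine (Tendsto.const_mul α ?_).add ((hprim T ⟨hT.le, le_rfl⟩).const_mul β)
  refine intervalIntegral.tendsto_integral_filter_of_dominated_convergence
    (fun _ => |R₀| + |c| * (Real.exp (u₁ * T) * T)) (Eventually.of_forall fun n => ?_)
    (Eventually.of_forall fun n => ae_of_all _ fun t ht => ?_) (by simp)
    (ae_of_all _ fun t ht =>
      tendsto_Kstate_of_tendsto_primitive hu₁.le R₀ c huN huo hprim (hsub ht))
  · exact (((huN n).continuousOn_Kstate R₀ c hT.le).mono hsub).aestronglyMeasurable
      measurableSet_uIoc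
  · exact (huN n).abs_Kstate_le hu₁.le R₀ c (hsub ht)
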